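/- arXiv:1807.00411 — 3 statements merged into one kernel-verified Lean document; each statement's English description precedes it below -/
import Mathlib

section
/- For every positive integer r, the sequence n ↦ z_n({3}^r; e^{2πi/n}) converges as n → ∞ to (1 + (-1)^r) · (-2πi)^{3r} / ((r+1) · (3r+2)!). That is, ξ({3}^r) = (1+(-1)^r)(-2πi)^{3r}/((r+1)(3r+2)!). -/
open Finset

/-- The set of tuples `(m_1,...,m_r)` with `n > m_1 > m_2 > ... > m_r > 0`. -/
def msets (n r : ℕ) : Finset (Fin r → Fin n) :=
  Finset.univ.filter fun m =>
    (∀ i j : Fin r, i < j → m j < m i) ∧ ∀ i, 0 < (m i : ℕ)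

/-- The set of tuples `(m_1,...,m_r)` with `n > m_1 ≥ m_2 ≥ ... ≥ m_r > 0`. -/
def msetsStar (n r : ℕ) : Finset (Fin r → Fin n) :=
  Finset.univ.filter fun m =>
    (∀ i j : Fin r, i ≤ j → m j ≤ m i) ∧ ∀ i, 0 < (m i : ℕ)

/-- The finite multiple harmonic q-series
`z_n(k_1,…,k_r; q) = Σ_{n > m_1 > … > m_r > 0} Π_i q^{(k_i-1)m_i}/[m_i]_q^{k_i}`,
where `[m]_q = (1-q^m)/(1-q)`. -/
noncomputable def z (n : ℕ) {r : ℕ} (k : Fin r → ℕ) (q : ℂ) : ℂ :=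
  ∑ m ∈ msets n r,
    ∏ i, q ^ ((k i - 1) * (m i : ℕ)) / ((1 - q ^ (m i : ℕ)) / (1 - q)) ^ (k i)

/-- The star version `z*_n(k; q)`, summed over `n > m_1 ≥ … ≥ m_r > 0`. -/
noncomputable def zstar (n : ℕ) {r : ℕ} (k : Fin r → ℕ) (q : ℂ) : ℂ :=
  ∑ m ∈ msetsStar n r,
    ∏ i, q ^ ((k i - 1) * (m i : ℕ)) / ((1 - q ^ (m i : ℕ)) / (1 - q)) ^ (k i)

/-- The modified value `z̄_n(k;q) = (1-q)^{-wt(k)} z_n(k;q)`. -/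
noncomputable def zbar (n : ℕ) {r : ℕ} (k : Fin r → ℕ) (q : ℂ) : ℂ :=
  (1 - q)⁻¹ ^ (∑ i, k i) * z n k q

/-- The modified star value `z̄*_n(k;q) = (1-q)^{-wt(k)} z*_n(k;q)`. -/
noncomputable def zstarbar (n : ℕ) {r : ℕ} (k : Fin r → ℕ) (q : ℂ) : ℂ :=
  (1 - q)⁻¹ ^ (∑ i, k i) * zstar n k q

/-- `I(k,r,s)`: the set of indices (tuples of positive integers) of weight `k`,
depth `r` and height `s`. -/
def indexSet3 (k r s : ℕ) : Finset (Fin r → ℕ) :=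
  (Finset.Nat.antidiagonalTuple r k).filter fun a =>
    (∀ i, 1 ≤ a i) ∧ (Finset.univ.filter fun i => 2 ≤ a i).card = s

/-- `I(k,r)`: the set of indices of weight `k` and depth `r`. -/
def indexSet2 (k r : ℕ) : Finset (Fin r → ℕ) :=
  (Finset.Nat.antidiagonalTuple r k).filter fun a => ∀ i, 1 ≤ a i

/-- The one-variable finite q-multiple polylogarithm
`L_{k_1,…,k_r}^{(n)}(t;q) = Σ_{n > m_1 > … > m_r > 0} t^{m_1} / Π_i (1-q^{m_i})^{k_i}`,
with `L_∅(t) = 1`. -/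
noncomputable def Lpoly (n : ℕ) {r : ℕ} (k : Fin r → ℕ) (q t : ℂ) : ℂ :=
  ∑ m ∈ msets n r,
    ∏ i : Fin r, (if i.val = 0 then t ^ (m i : ℕ) else 1) / (1 - q ^ (m i : ℕ)) ^ (k i)

/-- The star version `L*_{k_1,…,k_r}^{(n)}(t;q)`, summed over `n > m_1 ≥ … ≥ m_r > 0`. -/
noncomputable def LpolyStar (n : ℕ) {r : ℕ} (k : Fin r → ℕ) (q t : ℂ) : ℂ :=
  ∑ m ∈ msetsStar n r,
    ∏ i : Fin r, (if i.val = 0 then t ^ (m i : ℕ) else 1) / (1 - q ^ (m i : ℕ)) ^ (k i)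

open Polynomial in
lemma aux_prod_sub {q : ℂ} {n : ℕ} (hn : 0 < n) (hq : IsPrimitiveRoot q n) (a : ℂ) :
    ∏ k ∈ range n, (a - q ^ k) = a ^ n - 1 := by
  have h := X_pow_sub_C_eq_prod hq hn (one_pow n)
  have h2 := congrArg (Polynomial.eval a) h
  simp [Polynomial.eval_prod] at h2
  exact h2.symm

lemma aux_roots (T : ℂ) : ∃ a b c : ℂ, a + b + c = 3 + T ∧ a * b + a * c + b * c = 3 ∧
    a * b * c = 1 := by
  let P : Cubic ℂ := ⟨1, -(3 + T), 3, -1⟩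
  have ha : P.a ≠ 0 := one_ne_zero
  obtain ⟨a, b, c, h⟩ := (Cubic.splits_iff_roots_eq_three (φ := RingHom.id ℂ) ha).1
    (IsAlgClosed.splits _)
  have h1 := Cubic.b_eq_three_roots ha h
  have h2 := Cubic.c_eq_three_roots ha h
  have h3 := Cubic.d_eq_three_roots ha h
  simp [P] at h1 h2 h3
  refine ⟨a, b, c, ?_, ?_, ?_⟩
  · linear_combination h1
  · linear_combination -h2
  · linear_combination -h3

open Polynomial in
noncomputable def auxF : ℕ → ℂ[X]
  | 0 => C 3
  | 1 => C 3 + X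
  | 2 => C 3 + C 6 * X + X ^ 2
  | (n + 3) => (C 3 + X) * auxF (n + 2) - C 3 * auxF (n + 1) + auxF n

open Polynomial in
noncomputable def auxG : ℕ → ℂ[X]
  | 0 => C 3
  | 1 => C 3
  | 2 => C 3 - C 2 * X
  | (n + 3) => C 3 * auxG (n + 2) - (C 3 + X) * auxG (n + 1) + auxG n

lemma auxF_eval {a b c T : ℂ} (h1 : a + b + c = 3 + T) (h2 : a * b + a * c + b * c = 3)
    (h3 : a * b * c = 1) : ∀ n, (auxF n).eval T = a ^ n + b ^ n + c ^ n
  | 0 => by simp [auxF]; norm_num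
  | 1 => by simp [auxF]; linear_combination -h1
  | 2 => by
      simp [auxF]
      linear_combination (-a - b - c - 3 - T) * h1 + 2 * h2
  | (n + 3) => by
      have e0 := auxF_eval h1 h2 h3 n
      have e1 := auxF_eval h1 h2 h3 (n + 1)
      have e2 := auxF_eval h1 h2 h3 (n + 2)
      simp only [auxF, Polynomial.eval_add, Polynomial.eval_sub, Polynomial.eval_mul,
        Polynomial.eval_C, Polynomial.eval_X, e0, e1, e2]
      rw [← h1, ← h2]
      linear_combination (-(a ^ n + b ^ n + c ^ n)) * h3

lemma auxG_eval {a b c T : ℂ} (h1 : a + b + c = 3 + T) (h2 : a * b + a * c + b * c = 3)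
    (h3 : a * b * c = 1) :
    ∀ n, (auxG n).eval T = (a * b) ^ n + (a * c) ^ n + (b * c) ^ n
  | 0 => by simp [auxG]; norm_num
  | 1 => by simp [auxG]; linear_combination -h2
  | 2 => by
      simp [auxG]
      linear_combination 2 * h1 - (a * b + a * c + b * c + 3) * h2 + 2 * (a + b + c) * h3
  | (n + 3) => by
      have e0 := auxG_eval h1 h2 h3 n
      have e1 := auxG_eval h1 h2 h3 (n + 1)
      have e2 := auxG_eval h1 h2 h3 (n + 2)
      simp only [auxG, Polynomial.eval_add, Polynomial.eval_sub, Polynomial.eval_mul,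
        Polynomial.eval_C, Polynomial.eval_X, e0, e1, e2]
      rw [← h1, ← h2]
      have key : ∀ x y w : ℂ, x * y * w = 1 → ∀ m, x ^ (m + 3)
        = (x + y + w) * x ^ (m + 2) - (x * y + x * w + y * w) * x ^ (m + 1) + x ^ m := by
        intro x y w h m
        linear_combination (x ^ m) * h
      have k1 := key (a * b) (a * c) (b * c) (by linear_combination (a * b * c + 1) * h3) n
      have k2 := key (a * c) (a * b) (b * c) (by linear_combination (a * b * c + 1) * h3) n
      have k3 := key (b * c) (a * b) (a * c) (by linear_combination (a * b * c + 1) * h3) n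
      have e : a * b * (a * c) + a * b * (b * c) + a * c * (b * c) = a + b + c := by
        linear_combination (a + b + c) * h3
      linear_combination -k1 - k2 - k3 +
        ((a * b) ^ (n + 1) + (a * c) ^ (n + 1) + (b * c) ^ (n + 1)) * e

lemma aux_pascal (N k : ℕ) : ((N + 3).choose (k + 3) : ℂ) = 3 * (N + 2).choose (k + 3)
    - 3 * (N + 1).choose (k + 3) + N.choose (k + 3) + N.choose k := by
  simp only [Nat.choose_succ_succ, Nat.cast_add]
  ring

lemma auxF_coeff_zero : ∀ n, (auxF n).coeff 0 = 3
  | 0 => by simp [auxF]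
  | 1 => by simp [auxF]
  | 2 => by simp [auxF]
  | (n + 3) => by
      simp [auxF, add_mul, auxF_coeff_zero n, auxF_coeff_zero (n + 1), auxF_coeff_zero (n + 2)]

lemma auxG_coeff_zero : ∀ n, (auxG n).coeff 0 = 3
  | 0 => by simp [auxG]
  | 1 => by simp [auxG]
  | 2 => by simp [auxG]
  | (n + 3) => by
      simp [auxG, add_mul, auxG_coeff_zero n, auxG_coeff_zero (n + 1), auxG_coeff_zero (n + 2)]

lemma auxF_coeff : ∀ n k, (auxF n).coeff (k + 1) =
    ((n + 2 * k + 2).choose (3 * k + 3) : ℂ) + 2 * (n + 2 * k + 1).choose (3 * k + 3)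
  | 0, k => by
      rw [Nat.choose_eq_zero_of_lt (by omega), Nat.choose_eq_zero_of_lt (by omega)]
      simp [auxF]
  | 1, k => by
      rcases k with _ | k
      · simp [auxF, Nat.choose]
      · rw [Nat.choose_eq_zero_of_lt (by omega), Nat.choose_eq_zero_of_lt (by omega)]
        simp [auxF, Polynomial.coeff_X]
  | 2, k => by
      rcases k with _ | _ | k
      · simp [auxF, Nat.choose, Polynomial.coeff_X_pow]; norm_num
      · simp [auxF, Nat.choose, Polynomial.coeff_X_pow, Polynomial.coeff_X]
      · rw [Nat.choose_eq_zero_of_lt (by omega), Nat.choose_eq_zero_of_lt (by omega)]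
        simp [auxF, Polynomial.coeff_X, Polynomial.coeff_X_pow]
  | (n + 3), k => by
      have e0 := auxF_coeff n k
      have e1 := auxF_coeff (n + 1) k
      have e2 := auxF_coeff (n + 2) k
      have p1 := aux_pascal (n + 2 * k + 2) (3 * k)
      have p2 := aux_pascal (n + 2 * k + 1) (3 * k)
      have e3 : (auxF (n + 2)).coeff k =
          ((n + 2 * k + 2).choose (3 * k) : ℂ) + 2 * (n + 2 * k + 1).choose (3 * k) := by
        rcases k with _ | k
        · simp [auxF_coeff_zero]; norm_num
        · rw [auxF_coeff (n + 2) k]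
          ring_nf
      simp only [auxF, Polynomial.coeff_add, Polynomial.coeff_sub, add_mul, Polynomial.coeff_C_mul,
        Polynomial.coeff_X_mul, e0, e1, e2, e3]
      rw [show n + 3 + 2 * k + 2 = n + 2 * k + 2 + 3 by ring,
        show n + 3 + 2 * k + 1 = n + 2 * k + 1 + 3 by ring,
        show n + 2 + 2 * k + 2 = n + 2 * k + 2 + 2 by ring,
        show n + 2 + 2 * k + 1 = n + 2 * k + 1 + 2 by ring,
        show n + 1 + 2 * k + 2 = n + 2 * k + 2 + 1 by ring,
        show n + 1 + 2 * k + 1 = n + 2 * k + 1 + 1 by ring]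
      linear_combination -p1 - 2 * p2

lemma auxG_coeff : ∀ n k, (auxG n).coeff (k + 1) = (-1) ^ (k + 1) *
    (2 * ((n + k + 1).choose (3 * k + 3) : ℂ) + (n + k).choose (3 * k + 3))
  | 0, k => by
      rw [Nat.choose_eq_zero_of_lt (by omega), Nat.choose_eq_zero_of_lt (by omega)]
      simp [auxG]
  | 1, k => by
      rw [Nat.choose_eq_zero_of_lt (by omega), Nat.choose_eq_zero_of_lt (by omega)]
      simp [auxG]
  | 2, k => by
      rcases k with _ | k
      · simp [auxG, Nat.choose]
      · rw [Nat.choose_eq_zero_of_lt (by omega), Nat.choose_eq_zero_of_lt (by omega)]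
        simp [auxG, Polynomial.coeff_X]
  | (n + 3), k => by
      have e0 := auxG_coeff n k
      have e1 := auxG_coeff (n + 1) k
      have e2 := auxG_coeff (n + 2) k
      have p1 := aux_pascal (n + k + 1) (3 * k)
      have p2 := aux_pascal (n + k) (3 * k)
      have e3 : (auxG (n + 1)).coeff k = (-1) ^ k *
          (2 * ((n + k + 1).choose (3 * k) : ℂ) + (n + k).choose (3 * k)) := by
        rcases k with _ | k
        · simp [auxG_coeff_zero]; norm_num
        · rw [auxG_coeff (n + 1) k]
          ring_nf
      simp only [auxG, Polynomial.coeff_add, Polynomial.coeff_sub, add_mul, Polynomial.coeff_C_mul,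
        Polynomial.coeff_X_mul, e0, e1, e2, e3]
      rw [show n + 3 + k + 1 = n + k + 1 + 3 by ring,
        show n + 3 + k = n + k + 3 by ring,
        show n + 2 + k + 1 = n + k + 1 + 2 by ring,
        show n + 2 + k = n + k + 2 by ring,
        show n + 1 + k + 1 = n + k + 1 + 1 by ring,
        show n + 1 + k = n + k + 1 by ring]
      linear_combination (-(-1) ^ (k + 1)) * (2 * p1 + p2)

open Polynomial in
lemma aux_poly {q : ℂ} {N : ℕ} (hq : IsPrimitiveRoot q (N + 1)) :
    X * ∏ k ∈ range N, (C ((1 - q ^ (k + 1)) ^ 3) + C (q ^ (2 * (k + 1))) * X)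
      = auxF (N + 1) - auxG (N + 1) := by
  apply Polynomial.funext
  intro T
  obtain ⟨a, b, c, h1, h2, h3⟩ := aux_roots T
  rw [eval_sub, auxF_eval h1 h2 h3, auxG_eval h1 h2 h3]
  have hp : ∀ x : ℂ, (a - x) * (b - x) * (c - x) = (1 - x) ^ 3 + x ^ 2 * T := by
    intro x
    linear_combination x ^ 2 * h1 - x * h2 + h3
  have hprod : ∏ k ∈ range (N + 1), ((1 - q ^ k) ^ 3 + (q ^ k) ^ 2 * T)
      = (a ^ (N + 1) - 1) * (b ^ (N + 1) - 1) * (c ^ (N + 1) - 1) := by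
    simp_rw [← hp, prod_mul_distrib, aux_prod_sub (Nat.succ_pos N) hq]
  rw [prod_range_succ'] at hprod
  have h3' : a ^ (N + 1) * b ^ (N + 1) * c ^ (N + 1) = 1 := by
    rw [← mul_pow, ← mul_pow, h3, one_pow]
  simp only [eval_mul, eval_X, eval_prod, eval_add, eval_C, mul_pow]
  have : ∀ k, q ^ (2 * (k + 1)) = (q ^ (k + 1)) ^ 2 := fun k => by rw [← pow_mul, mul_comm]
  simp_rw [this]
  simp only [pow_zero, sub_self] at hprod
  linear_combination hprod + h3'

open Polynomial in
lemma aux_coeff_prod (s : Finset ℕ) (f : ℕ → ℂ) (r : ℕ) :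
    (∏ i ∈ s, (1 + C (f i) * X)).coeff r = ∑ t ∈ powersetCard r s, ∏ i ∈ t, f i := by
  rw [prod_one_add, finsetSum_coeff]
  rw [powersetCard_eq_filter, sum_filter]
  refine sum_congr rfl fun t _ => ?_
  rw [prod_mul_distrib, prod_const, ← map_prod, coeff_C_mul, coeff_X_pow]
  simp [eq_comm]

open Polynomial in
lemma aux_esymm {q : ℂ} {N : ℕ} (hq : IsPrimitiveRoot q (N + 1)) (r : ℕ) :
    ((N : ℂ) + 1) ^ 3 * ∑ t ∈ powersetCard r (range N), ∏ k ∈ t,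
      (q ^ (2 * (k + 1)) / (1 - q ^ (k + 1)) ^ 3)
      = (auxF (N + 1)).coeff (r + 1) - (auxG (N + 1)).coeff (r + 1) := by
  rw [← coeff_sub, ← aux_poly hq, coeff_X_mul, ← aux_coeff_prod, ← hq.prod_one_sub_pow_eq_order,
    ← prod_pow, ← coeff_C_mul, map_prod, ← prod_mul_distrib]
  congr 1
  refine prod_congr rfl fun k hk => ?_
  have hne : (1 - q ^ (k + 1)) ≠ 0 := by
    have := hq.pow_ne_one_of_pos_of_lt (Nat.succ_ne_zero k) (by simpa using hk)
    exact sub_ne_zero.2 (Ne.symm this)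
  rw [mul_add, mul_one, ← mul_assoc, ← C_mul]
  congr 3
  field_simp

lemma aux_msets (N r : ℕ) (f : ℕ → ℂ) :
    ∑ m ∈ msets (N + 1) r, ∏ i, f (m i : ℕ)
      = ∑ t ∈ powersetCard r (range N), ∏ k ∈ t, f (k + 1) := by
  refine sum_bij (fun m _ => univ.image fun i => (m i : ℕ) - 1) ?_ ?_ ?_ ?_
  · intro m hm
    simp only [msets, mem_filter, mem_univ, true_and] at hm
    rw [mem_powersetCard]
    constructor
    · intro x hx
      simp only [mem_image, mem_univ, true_and] at hx
      obtain ⟨i, rfl⟩ := hx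
      have := (m i).2
      have := hm.2 i
      simp only [mem_range]; omega
    · rw [card_image_of_injective, card_univ, Fintype.card_fin]
      intro i j hij
      have h1 := hm.2 i
      have h2 := hm.2 j
      simp only at hij
      have h3 : m i = m j := Fin.ext (by omega)
      rcases lt_trichotomy i j with h | h | h
      · exact absurd h3 (hm.1 i j h).ne'
      · exact h
      · exact absurd h3 (hm.1 j i h).ne
  · intro m hm m' hm' h
    simp only [msets, mem_filter, mem_univ, true_and] at hm hm'
    have s1 : StrictAnti (fun i => (m i : ℕ) - 1) := by
      intro i j hij
      have := hm.1 i j hij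
      have := hm.2 j
      simp only [Fin.lt_def] at *; omega
    have s2 : StrictAnti (fun i => (m' i : ℕ) - 1) := by
      intro i j hij
      have := hm'.1 i j hij
      have := hm'.2 j
      simp only [Fin.lt_def] at *; omega
    have h' := (s1.range_inj s2).1 (by
      have := congrArg (fun s : Finset ℕ => (s : Set ℕ)) h
      simpa using this)
    funext i
    have e1 : (m i : ℕ) - 1 = (m' i : ℕ) - 1 := congrFun h' i
    have e2 := hm.2 i
    have e3 := hm'.2 i
    apply Fin.ext
    omega
  · intro t ht
    rw [mem_powersetCard] at ht
    let e := t.orderEmbOfFin ht.2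
    have hlt : ∀ i, e i < N := fun i => by
      have := ht.1 (t.orderEmbOfFin_mem ht.2 i)
      simpa using this
    refine ⟨fun i => ⟨e i.rev + 1, by have := hlt i.rev; omega⟩, ?_, ?_⟩
    · simp only [msets, mem_filter, mem_univ, true_and]
      refine ⟨fun i j hij => ?_, fun i => by simp⟩
      simp only [Fin.lt_def]
      have : e j.rev < e i.rev := e.strictMono (Fin.rev_lt_rev.2 hij)
      omega
    · ext x
      have := t.range_orderEmbOfFin ht.2
      rw [← mem_coe, ← mem_coe, ← this]
      simp only [coe_image, coe_univ, Set.image_univ, Set.mem_range, Nat.add_sub_cancel]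
      constructor
      · rintro ⟨y, hy⟩; exact ⟨y.rev, hy⟩
      · rintro ⟨y, hy⟩; exact ⟨y.rev, by rw [Fin.rev_rev]; exact hy⟩
  · intro m hm
    simp only [msets, mem_filter, mem_univ, true_and] at hm
    rw [prod_image]
    · refine prod_congr rfl fun i _ => ?_
      rw [Nat.sub_add_cancel (hm.2 i)]
    · intro i _ j _ hij
      have h1 := hm.2 i
      have h2 := hm.2 j
      simp only at hij
      have h3 : m i = m j := Fin.ext (by omega)
      rcases lt_trichotomy i j with h | h | h
      · exact absurd h3 (hm.1 i j h).ne'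
      · exact h
      · exact absurd h3 (hm.1 j i h).ne

lemma aux_z {q : ℂ} {n : ℕ} (hn : 0 < n) (hq : IsPrimitiveRoot q n) (r : ℕ) :
    z n (fun _ : Fin r => 3) q = ((n : ℂ) * (1 - q)) ^ (3 * r) *
      (((n + 2 * r + 2).choose (3 * r + 3) : ℂ) / (n : ℂ) ^ (3 * r + 3)
        + 2 * (((n + (2 * r + 1)).choose (3 * r + 3) : ℂ) / (n : ℂ) ^ (3 * r + 3))
        + (-1) ^ r * (2 * (((n + (r + 1)).choose (3 * r + 3) : ℂ) / (n : ℂ) ^ (3 * r + 3))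
        + ((n + r).choose (3 * r + 3) : ℂ) / (n : ℂ) ^ (3 * r + 3))) := by
  obtain ⟨N, rfl⟩ : ∃ N, n = N + 1 := ⟨n - 1, by omega⟩
  have h := aux_esymm hq r
  rw [auxF_coeff, auxG_coeff] at h
  have hN : ((N : ℂ) + 1) ≠ 0 := by exact_mod_cast Nat.succ_ne_zero N
  have hz : z (N + 1) (fun _ : Fin r => 3) q = (1 - q) ^ (3 * r) *
      ∑ t ∈ powersetCard r (range N), ∏ k ∈ t,
      (q ^ (2 * (k + 1)) / (1 - q ^ (k + 1)) ^ 3) := by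
    rw [← aux_msets N r (fun k => q ^ (2 * k) / (1 - q ^ k) ^ 3), z, mul_sum]
    refine sum_congr rfl fun m _ => ?_
    have : (1 - q) ^ (3 * r) = ∏ _i : Fin r, (1 - q) ^ 3 := by
      rw [prod_const, card_univ, Fintype.card_fin, pow_mul]
    rw [this, ← prod_mul_distrib]
    refine prod_congr rfl fun i _ => ?_
    simp only [div_pow, Nat.add_one_sub_one]
    rw [div_div_eq_mul_div]
    ring
  rw [hz, mul_pow]
  push_cast
  rw [mul_comm, ← eq_div_iff (pow_ne_zero 3 hN)] at h
  rw [h, ← add_assoc (N+1) (2*r) 1, ← add_assoc (N+1) r 1, pow_add _ (3 * r) 3]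
  field_simp
  ring

lemma aux_choose (j k : ℕ) : Filter.Tendsto
    (fun n : ℕ => ((n + j).choose k : ℂ) / (n : ℂ) ^ k) Filter.atTop
    (nhds (1 / (k.factorial : ℂ))) := by
  have h1 : Filter.Tendsto (fun n : ℕ => ((n.choose k : ℕ) : ℝ) / (n : ℝ) ^ k) Filter.atTop
      (nhds (1 / (k.factorial : ℝ))) := by
    have := (isEquivalent_choose k).div (Asymptotics.IsEquivalent.refl (u := fun n : ℕ => (n : ℝ) ^ k))
    refine this.symm.tendsto_nhds ?_
    refine tendsto_const_nhds.congr' ?_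
    filter_upwards [Filter.eventually_gt_atTop 0] with n hn
    have : (n : ℝ) ≠ 0 := by positivity
    simp only [Pi.div_apply]
    field_simp
  have h2 := h1.comp (Filter.tendsto_add_atTop_nat j)
  have h3 : Filter.Tendsto (fun n : ℕ => (((n : ℝ) + j) / n) ^ k) Filter.atTop (nhds 1) := by
    have : Filter.Tendsto (fun n : ℕ => 1 + (j : ℝ) / n) Filter.atTop (nhds (1 + 0)) :=
      tendsto_const_nhds.add (tendsto_const_div_atTop_nhds_zero_nat _)
    have := this.pow k
    simp only [add_zero, one_pow] at this
    refine this.congr' ?_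
    filter_upwards [Filter.eventually_gt_atTop 0] with n hn
    have : (n : ℝ) ≠ 0 := by positivity
    congr 1
    field_simp
  have h4 : Filter.Tendsto (fun n : ℕ => ((n + j).choose k : ℝ) / (n : ℝ) ^ k) Filter.atTop
    (nhds (1 / (k.factorial : ℝ))) := by
    have := h2.mul h3
    rw [mul_one] at this
    refine this.congr' ?_
    filter_upwards [Filter.eventually_gt_atTop 0] with n hn
    have : (n : ℝ) ≠ 0 := by positivity
    have : (n : ℝ) + j ≠ 0 := by positivity
    simp only [Function.comp, Nat.cast_add, div_pow]
    field_simp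
  have := (Complex.continuous_ofReal.tendsto _).comp h4
  simpa [Function.comp_def] using this

lemma aux_exp : Filter.Tendsto (fun n : ℕ => (n : ℂ) *
    (1 - Complex.exp (2 * (Real.pi : ℂ) * Complex.I / (n : ℂ)))) Filter.atTop
    (nhds (-(2 * (Real.pi : ℂ) * Complex.I))) := by
  set w : ℂ := 2 * (Real.pi : ℂ) * Complex.I with hw
  have hw0 : w ≠ 0 := Complex.two_pi_I_ne_zero
  have h := hasDerivAt_iff_tendsto_slope.1 (Complex.hasDerivAt_exp 0)
  have ht : Filter.Tendsto (fun n : ℕ => w / (n : ℂ)) Filter.atTop (nhdsWithin 0 {0}ᶜ) := by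
    rw [tendsto_nhdsWithin_iff]
    refine ⟨tendsto_const_div_atTop_nhds_zero_nat _, ?_⟩
    filter_upwards [Filter.eventually_gt_atTop 0] with n hn
    have : (n : ℂ) ≠ 0 := by exact_mod_cast hn.ne'
    simp [hw0, this]
  have h2 := (h.comp ht).const_mul (-w)
  rw [Complex.exp_zero, mul_one] at h2
  refine h2.congr' ?_
  filter_upwards [Filter.eventually_gt_atTop 0] with n hn
  have : (n : ℂ) ≠ 0 := by exact_mod_cast hn.ne'
  simp only [Function.comp, slope_def_field, Complex.exp_zero, sub_zero]
  field_simp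
  ring

/-- `ξ({3}^r) = lim_{n→∞} z_n({3}^r; e^{2πi/n})
  = (1+(-1)^r)·(-2πi)^{3r}/((r+1)(3r+2)!)`. -/
theorem xi_threes (r : ℕ) (hr : 1 ≤ r) :
    Filter.Tendsto
      (fun n : ℕ => z n (fun _ : Fin r => 3)
        (Complex.exp (2 * (Real.pi : ℂ) * Complex.I / (n : ℂ))))
      Filter.atTop
      (nhds ((1 + (-1 : ℂ) ^ r) * (-(2 * (Real.pi : ℂ) * Complex.I)) ^ (3 * r) /
        (((r : ℂ) + 1) * (Nat.factorial (3 * r + 2) : ℂ)))) := by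
  have hk := fun j => aux_choose j (3 * r + 3)
  have hlim := (aux_exp.pow (3 * r)).mul (((hk (2 * r + 2)).add ((hk (2 * r + 1)).const_mul 2)).add
    ((((hk (r + 1)).const_mul 2).add (hk r)).const_mul ((-1 : ℂ) ^ r)))
  have hval : (1 + (-1 : ℂ) ^ r) * (-(2 * (Real.pi : ℂ) * Complex.I)) ^ (3 * r) /
        (((r : ℂ) + 1) * (Nat.factorial (3 * r + 2) : ℂ)) =
      (-(2 * (Real.pi : ℂ) * Complex.I)) ^ (3 * r) *
      (1 / (Nat.factorial (3 * r + 3) : ℂ) + 2 * (1 / (Nat.factorial (3 * r + 3) : ℂ)) +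
        (-1 : ℂ) ^ r * (2 * (1 / (Nat.factorial (3 * r + 3) : ℂ)) +
          1 / (Nat.factorial (3 * r + 3) : ℂ))) := by
    rw [Nat.factorial_succ (3 * r + 2)]
    have h1 : (r : ℂ) + 1 ≠ 0 := by exact_mod_cast Nat.succ_ne_zero r
    have h2 : ((3 * r + 2).factorial : ℂ) ≠ 0 := by exact_mod_cast Nat.factorial_ne_zero _
    have h3 : (((3 * r + 2 + 1) * (3 * r + 2).factorial : ℕ) : ℂ)
        = 3 * ((r : ℂ) + 1) * ((3 * r + 2).factorial : ℂ) := by push_cast; ring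
    rw [h3]
    field_simp
    ring
  rw [hval]
  refine hlim.congr' ?_
  filter_upwards [Filter.eventually_gt_atTop 0] with n hn
  rw [aux_z hn (Complex.isPrimitiveRoot_exp n hn.ne')]
  simp only [add_assoc]
end

section
/- Let k ≥ r ≥ 1 be integers. Then the sequence n ↦ Σ_{k ∈ I(k,r)} z_n(k; e^{2πi/n}), summed over all indices of weight k and depth r, converges as n → ∞ to -((-2πi)^k / (k+1)!) · Σ_{j=1}^{r} binom(k+1, j) · B_{k+1-j}, where B_m is the m-th Bernoulli number with the convention B_1 = -1/2. -/
open Finset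

open PowerSeries in
/-- The series `∑_j q^{jm} X^j / (1-q^m)^{j+1} = 1 / (1 - q^m (1+X))`. -/
noncomputable def Fser (q : ℂ) (m : ℕ) : PowerSeries ℂ :=
  PowerSeries.mk fun j => q ^ (j * m) / (1 - q ^ m) ^ (j + 1)

lemma Fser_mul (q : ℂ) (m : ℕ) (h : q ^ m ≠ 1) :
    Fser q m * (1 - PowerSeries.C (q ^ m) * (1 + PowerSeries.X)) = 1 := by
  have h1 : 1 - q ^ m ≠ 0 := sub_ne_zero.mpr (Ne.symm h)
  have e : (1 - PowerSeries.C (q ^ m) * (1 + PowerSeries.X) : PowerSeries ℂ)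
      = PowerSeries.C (1 - q ^ m) - PowerSeries.C (q ^ m) * PowerSeries.X := by
    simp only [map_sub, map_one]; ring
  rw [e, mul_sub]
  ext d
  have e2 : Fser q m * (PowerSeries.C (q ^ m) * PowerSeries.X)
      = (Fser q m * PowerSeries.C (q ^ m)) * PowerSeries.X := by ring
  rw [e2, map_sub, PowerSeries.coeff_mul_C]
  cases d with
  | zero => simp [Fser, h1]
  | succ d =>
    rw [PowerSeries.coeff_succ_mul_X, PowerSeries.coeff_mul_C]
    simp only [Fser, PowerSeries.coeff_mk, PowerSeries.coeff_one]
    simp only [Nat.add_eq_zero_iff, one_ne_zero, and_false, if_false]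
    rw [pow_succ (1 - q ^ m) (d+1), add_mul, pow_add]
    field_simp
    ring

lemma sum_index_prod (k r : ℕ) (hkr : r ≤ k) (q : ℂ) (m : Fin r → ℕ) :
    ∑ a ∈ indexSet2 k r, ∏ i, q ^ ((a i - 1) * m i) / ((1 - q ^ m i) / (1 - q)) ^ (a i)
      = (1 - q) ^ k * PowerSeries.coeff (k - r) (∏ i, Fser q (m i)) := by
  rw [PowerSeries.coeff_prod, Finset.mul_sum]
  refine Finset.sum_bij' (fun a _ => Finsupp.equivFunOnFinite.symm (fun i => a i - 1))
    (fun b _ => fun i => b i + 1) ?_ ?_ ?_ ?_ ?_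
  · intro a ha
    simp only [indexSet2, Finset.mem_filter, Finset.Nat.mem_antidiagonalTuple] at ha
    simp only [Finset.mem_finsuppAntidiag, Finsupp.equivFunOnFinite_symm_apply_apply,
      Finset.subset_univ, and_true]
    have : ∑ i, a i = ∑ i, (a i - 1) + r := by
      have h1 : ∑ i : Fin r, 1 = r := by simp
      have h2 : ∑ i, a i = ∑ i, (a i - 1) + ∑ i : Fin r, 1 := by
        rw [← Finset.sum_add_distrib]
        exact Finset.sum_congr rfl fun i _ => by have := ha.2 i; omega
      omega
    omega
  · intro b hb
    simp only [Finset.mem_finsuppAntidiag] at hb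
    simp only [indexSet2, Finset.mem_filter, Finset.Nat.mem_antidiagonalTuple,
      Finset.sum_add_distrib, hb.1]
    simp
    omega
  · intro a ha
    simp only [indexSet2, Finset.mem_filter, Finset.Nat.mem_antidiagonalTuple] at ha
    funext i
    have := ha.2 i
    simp
    omega
  · intro b hb
    ext i
    simp
  · intro a ha
    simp only [indexSet2, Finset.mem_filter, Finset.Nat.mem_antidiagonalTuple] at ha
    rw [← ha.1, ← Finset.prod_pow_eq_pow_sum, ← Finset.prod_mul_distrib]
    refine Finset.prod_congr rfl fun i _ => ?_
    obtain ⟨c, hc⟩ := Nat.exists_eq_add_of_le' (ha.2 i)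
    simp only [Fser, PowerSeries.coeff_mk, Finsupp.equivFunOnFinite_symm_apply_apply, hc,
      Nat.add_sub_cancel]
    rw [div_pow, div_div_eq_mul_div]
    ring

lemma sum_msets {R : Type*} [CommSemiring R] (n r : ℕ) (F : ℕ → R) :
    ∑ m ∈ msets n r, ∏ i, F (m i : ℕ)
      = ∑ S ∈ (Finset.Ioo 0 n).powersetCard r, ∏ m ∈ S, F m := by
  have inj : ∀ m ∈ msets n r, Function.Injective (fun i => (m i : ℕ)) := by
    intro m hm
    simp only [msets, Finset.mem_filter] at hm
    have : StrictAnti m := fun i j h => hm.2.1 i j h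
    exact Fin.val_injective.comp this.injective
  refine Finset.sum_bij (fun m _ => Finset.univ.image fun i => (m i : ℕ)) ?_ ?_ ?_ ?_
  · intro m hm
    rw [Finset.mem_powersetCard]
    refine ⟨?_, ?_⟩
    · intro x hx
      simp only [msets, Finset.mem_filter] at hm
      obtain ⟨i, _, rfl⟩ := Finset.mem_image.mp hx
      simpa using hm.2.2 i
    · rw [Finset.card_image_of_injective _ (inj m hm)]; simp
  · intro m hm m' hm' h
    simp only [msets, Finset.mem_filter] at hm hm'
    have h1 : StrictMono (fun i : Fin r => (m i.rev : ℕ)) :=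
      fun i j h => hm.2.1 _ _ (Fin.rev_lt_rev.mpr h)
    have h2 : StrictMono (fun i : Fin r => (m' i.rev : ℕ)) :=
      fun i j h => hm'.2.1 _ _ (Fin.rev_lt_rev.mpr h)
    have h3 : (fun i : Fin r => (m i.rev : ℕ)) = (fun i : Fin r => (m' i.rev : ℕ)) := by
      refine (StrictMono.range_inj h1 h2).mp ?_
      have h4 : Set.range (fun i => (m i : ℕ)) = Set.range (fun i => (m' i : ℕ)) := by
        have := congrArg (fun s : Finset ℕ => (s : Set ℕ)) h
        simpa using this
      have e1 := Fin.rev_surjective.range_comp (fun i : Fin r => (m i : ℕ))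
      have e2 := Fin.rev_surjective.range_comp (fun i : Fin r => (m' i : ℕ))
      exact e1.trans (h4.trans e2.symm)
    funext i
    have := congrFun h3 i.rev
    simp only [Fin.rev_rev] at this
    exact Fin.ext this
  · intro S hS
    rw [Finset.mem_powersetCard] at hS
    have hmem : ∀ i, S.orderEmbOfFin hS.2 i ∈ Finset.Ioo 0 n :=
      fun i => hS.1 (S.orderEmbOfFin_mem hS.2 i)
    refine ⟨fun i => ⟨S.orderEmbOfFin hS.2 i.rev, (Finset.mem_Ioo.mp (hmem _)).2⟩, ?_, ?_⟩
    · simp only [msets, Finset.mem_filter, Finset.mem_univ, true_and]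
      refine ⟨fun i j h => ?_, fun i => (Finset.mem_Ioo.mp (hmem _)).1⟩
      rw [Fin.mk_lt_mk]
      exact (S.orderEmbOfFin hS.2).strictMono (Fin.rev_lt_rev.mpr h)
    · apply Finset.coe_injective
      simp only [Finset.coe_image, Finset.coe_univ, Set.image_univ]
      have e1 := Fin.rev_surjective.range_comp (fun i : Fin r => S.orderEmbOfFin hS.2 i)
      exact e1.trans (S.range_orderEmbOfFin hS.2)
  · intro m hm
    rw [Finset.prod_image fun i _ j _ h => inj m hm h]

/-- elementary symmetric function of the `Fser`. -/
noncomputable def eser (n r : ℕ) (q : ℂ) : PowerSeries ℂ :=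
  ∑ S ∈ (Finset.Ioo 0 n).powersetCard r, ∏ m ∈ S, Fser q m

lemma sum_z (k r n : ℕ) (hkr : r ≤ k) (q : ℂ) :
    ∑ a ∈ indexSet2 k r, z n a q = (1 - q) ^ k * PowerSeries.coeff (k - r) (eser n r q) := by
  unfold z
  rw [Finset.sum_comm, eser, ← sum_msets, map_sum, Finset.mul_sum]
  exact Finset.sum_congr rfl fun m _ => sum_index_prod k r hkr q _

/-- the denominator -/
noncomputable def User (n : ℕ) (q : ℂ) : PowerSeries ℂ :=
  ∏ m ∈ Finset.Ioo 0 n, (1 - PowerSeries.C (q ^ m) * (1 + PowerSeries.X))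

open Polynomial in
lemma coeff_prod_one_add {R : Type*} [CommRing R] (s : Finset ℕ) (F : ℕ → R) (r : ℕ) :
    (∏ m ∈ s, (1 + X * C (F m)) : R[X]).coeff r = ∑ S ∈ s.powersetCard r, ∏ m ∈ S, F m := by
  rw [Finset.prod_one_add, Polynomial.finsetSum_coeff]
  simp only [Finset.prod_mul_distrib, Finset.prod_const, ← map_prod, Polynomial.coeff_X_pow_mul',
    Polynomial.coeff_C]
  rw [← Finset.sum_filter_add_sum_filter_not s.powerset (fun S => S.card = r)]
  rw [← Finset.powersetCard_eq_filter]
  have h0 : ∑ x ∈ s.powerset with ¬ x.card = r,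
      (if x.card ≤ r then if r - x.card = 0 then ∏ i ∈ x, F i else 0 else 0) = 0 := by
    refine Finset.sum_eq_zero fun x hx => ?_
    have := (Finset.mem_filter.mp hx).2
    split_ifs <;> first | rfl | omega
  rw [h0, add_zero]
  refine Finset.sum_congr rfl fun x hx => ?_
  have := (Finset.mem_powersetCard.mp hx).2
  simp [this]

open Polynomial in
lemma coeff_U_mul (n : ℕ) (hn : 0 < n) (q : ℂ) (hq : IsPrimitiveRoot q n) (r i : ℕ) :
    PowerSeries.coeff i (User n q * eser n r q) = (n.choose (r + 1 + i) : ℂ) := by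
  set D : (PowerSeries ℂ)[X] := ∏ m ∈ Finset.Ioo 0 n,
    (X + 1 - C (PowerSeries.C (q ^ m) * (1 + PowerSeries.X))) with hD
  have hne : ∀ m ∈ Finset.Ioo 0 n, q ^ m ≠ 1 := fun m hm =>
    hq.pow_ne_one_of_pos_of_lt (Finset.mem_Ioo.mp hm).1.ne' (Finset.mem_Ioo.mp hm).2
  have hDr : ∀ r, D.coeff r = User n q * eser n r q := by
    intro r
    have : D = C (User n q) * ∏ m ∈ Finset.Ioo 0 n, (1 + X * C (Fser q m)) := by
      rw [hD, User, map_prod, ← Finset.prod_mul_distrib]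
      refine Finset.prod_congr rfl fun m hm => ?_
      have h := congrArg (C : PowerSeries ℂ → (PowerSeries ℂ)[X]) (Fser_mul q m (hne m hm))
      rw [map_mul, map_one] at h
      rw [map_sub, map_one] at h ⊢
      linear_combination (-X) * h
    rw [this, coeff_C_mul, coeff_prod_one_add, eser]
  have hmain : (X - C PowerSeries.X) * D = (X + 1) ^ n - C ((1 + PowerSeries.X) ^ n) := by
    have hz : IsPrimitiveRoot (PowerSeries.C q : PowerSeries ℂ) n :=
      hq.map_of_injective PowerSeries.C_injective
    have h := X_pow_sub_C_eq_prod hz (α := 1 + PowerSeries.X) hn rfl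
    have h2 := congrArg (fun p : (PowerSeries ℂ)[X] => p.comp (X + 1)) h
    simp only [sub_comp, pow_comp, X_comp, C_comp, Polynomial.prod_comp] at h2
    refine Eq.trans ?_ h2.symm
    clear h h2
    have : Finset.range n = insert 0 (Finset.Ioo 0 n) := by
      ext x; simp; omega
    rw [this, Finset.prod_insert (by simp), hD]
    have e1 : (X + 1 - C (PowerSeries.C q ^ 0 * (1 + PowerSeries.X)) : (PowerSeries ℂ)[X])
        = X - C PowerSeries.X := by
      rw [pow_zero, one_mul, map_add, map_one]; ring
    rw [e1]
    simp only [map_pow]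
  have hc := fun j => congrArg (fun p : (PowerSeries ℂ)[X] => p.coeff j) hmain
  simp only [coeff_sub, sub_mul, coeff_C_mul] at hc
  rw [← hDr]
  induction r generalizing i with
  | zero =>
    have h0 := hc 0
    rw [mul_comm X, coeff_mul_X_zero] at h0
    simp only [coeff_X_add_one_pow, coeff_C_zero] at h0
    have := congrArg (PowerSeries.coeff (i + 1)) h0
    have e : (1 + PowerSeries.X : PowerSeries ℂ) ^ n = (((X + 1) ^ n : ℂ[X]) : PowerSeries ℂ) := by
      simp [add_comm]
    rw [e, map_sub, map_sub, Polynomial.coeff_coe, coeff_X_add_one_pow, map_zero,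
      PowerSeries.coeff_succ_X_mul, Nat.choose_zero_right, Nat.cast_one, PowerSeries.coeff_one,
      if_neg (Nat.succ_ne_zero i), zero_sub, zero_sub, neg_inj] at this
    rw [this]; congr 2; omega
  | succ r ih =>
    have h0 := hc (r + 1)
    rw [coeff_X_mul, coeff_C_succ, coeff_X_add_one_pow] at h0
    have := congrArg (PowerSeries.coeff (i + 1)) h0
    rw [map_sub, ih, PowerSeries.coeff_succ_X_mul] at this
    have e : PowerSeries.coeff (i+1) ((n.choose (r+1) : PowerSeries ℂ)) = 0 := by
      have : ((n.choose (r+1) : ℕ) : PowerSeries ℂ) = PowerSeries.C ((n.choose (r+1) : ℕ) : ℂ) := by simp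
      rw [this, PowerSeries.coeff_C]; simp
    rw [sub_zero, e, sub_eq_zero] at this
    rw [← this]; congr 2; omega

lemma conv (n : ℕ) (hn : 0 < n) (q : ℂ) (hq : IsPrimitiveRoot q n) (r d : ℕ) :
    ∑ p ∈ Finset.HasAntidiagonal.antidiagonal d, (n.choose (p.1 + 1) : ℂ) * (PowerSeries.coeff p.2 (eser n r q))
      = n.choose (r + 1 + d) := by
  rw [← coeff_U_mul n hn q hq r d, PowerSeries.coeff_mul]
  refine Finset.sum_congr rfl fun p _ => ?_
  congr 1
  have := coeff_U_mul n hn q hq 0 p.1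
  simp only [eser, Finset.powersetCard_zero, Finset.sum_singleton, Finset.prod_empty, mul_one]
    at this
  rw [this]; congr 2; omega

lemma conv' (n : ℕ) (hn : 0 < n) (q : ℂ) (hq : IsPrimitiveRoot q n) (r d : ℕ) :
    ∑ p ∈ Finset.HasAntidiagonal.antidiagonal d, ((n.choose (p.1 + 1) : ℂ) * (1 / n : ℂ) ^ (p.1 + 1)) *
        ((PowerSeries.coeff p.2 (eser n r q)) * (1 / n : ℂ) ^ (r + p.2))
      = n.choose (r + 1 + d) * (1 / n : ℂ) ^ (r + 1 + d) := by
  rw [← conv n hn q hq r d, Finset.sum_mul]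
  refine Finset.sum_congr rfl fun p hp => ?_
  rw [← Finset.HasAntidiagonal.mem_antidiagonal.mp hp]
  ring

lemma tendsto_choose_c (j : ℕ) :
    Filter.Tendsto (fun n : ℕ => (n.choose j : ℂ) * (1 / n : ℂ) ^ j) Filter.atTop
      (nhds (1 / (j.factorial : ℂ))) := by
  have h : Filter.Tendsto (fun n : ℕ => (n : ℝ) * (1 / n : ℝ)) Filter.atTop (nhds 1) := by
    refine tendsto_const_nhds.congr' ?_
    filter_upwards [Filter.eventually_gt_atTop 0] with n hn
    have : (n : ℝ) ≠ 0 := by positivity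
    field_simp
  have h2 := ProbabilityTheory.tendsto_choose_mul_pow_atTop j h
  have h3 := (Complex.continuous_ofReal.tendsto _).comp h2
  convert h3 using 2
  · simp
  · simp

/-- limit series numerators -/
noncomputable def Tser (r : ℕ) : PowerSeries ℂ :=
  PowerSeries.mk fun d => 1 / ((r + 1 + d).factorial : ℂ)

noncomputable def Lser (r : ℕ) : PowerSeries ℂ := bernoulliPowerSeries ℂ * Tser r

lemma Lser_conv (r : ℕ) : Tser 0 * Lser r = Tser r := by
  have h := bernoulliPowerSeries_mul_exp_sub_one ℂ
  have e : PowerSeries.exp ℂ - 1 = PowerSeries.X * Tser 0 := by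
    ext d
    cases d with
    | zero => simp
    | succ d =>
      rw [PowerSeries.coeff_succ_X_mul]
      simp [Tser, PowerSeries.coeff_exp, PowerSeries.coeff_one, add_comm]
  rw [e, mul_left_comm] at h
  have h1 : bernoulliPowerSeries ℂ * Tser 0 = 1 :=
    mul_left_cancel₀ PowerSeries.X_ne_zero (by rw [h, mul_one])
  rw [Lser, ← mul_assoc, mul_comm (Tser 0), h1, one_mul]

lemma Lser_coeff (r k : ℕ) (hr : 1 ≤ r) (hkr : r ≤ k) :
    PowerSeries.coeff (k - r) (Lser r) =
      -(1 / ((k + 1).factorial : ℂ)) * ∑ j ∈ Finset.Icc 1 r,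
          ((k + 1).choose j : ℂ) * ((bernoulli (k + 1 - j) : ℚ) : ℂ) := by
  set S : PowerSeries ℂ := ∑ j ∈ Finset.Icc 1 r, PowerSeries.X ^ j * PowerSeries.C (1 / (j.factorial : ℂ))
    with hS
  have e : PowerSeries.exp ℂ - 1 - S = PowerSeries.X ^ (r + 1) * Tser r := by
    ext d
    rw [PowerSeries.coeff_X_pow_mul', hS, map_sub, map_sum, map_sub]
    simp only [PowerSeries.coeff_X_pow_mul', PowerSeries.coeff_C, Tser, PowerSeries.coeff_mk,
      PowerSeries.coeff_exp, PowerSeries.coeff_one]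
    have : ∀ j ∈ Finset.Icc 1 r, (if j ≤ d then if d - j = 0 then 1 / (j.factorial : ℂ) else 0 else 0)
        = if d = j then 1 / (d.factorial : ℂ) else 0 := by
      intro j _
      by_cases h : d = j
      · simp [h]
      · split_ifs <;> first | rfl | omega
    rw [Finset.sum_congr rfl this, Finset.sum_ite_eq]
    rcases Nat.eq_zero_or_pos d with rfl | hd
    · simp
    · by_cases h : d ≤ r
      · have : ¬ (r + 1 ≤ d) := by omega
        simp [this, h, hd.ne', Nat.one_le_iff_ne_zero]
      · have h' : r + 1 ≤ d := by omega
        have h3 : r + 1 + (d - (r + 1)) = d := by omega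
        simp [h, h', hd.ne', h3]
  have h := congrArg (fun s => bernoulliPowerSeries ℂ * s) e
  simp only [mul_sub _ _ S, bernoulliPowerSeries_mul_exp_sub_one] at h
  rw [mul_left_comm] at h
  have hc := congrArg (PowerSeries.coeff (k + 1)) h
  rw [PowerSeries.coeff_X_pow_mul', if_pos (by omega), Nat.add_sub_add_right] at hc
  rw [Lser, ← hc, map_sub, PowerSeries.coeff_X, if_neg (by omega), zero_sub, neg_mul, hS,
    Finset.mul_sum, Finset.mul_sum, map_sum]
  congr 1
  refine Finset.sum_congr rfl fun j hj => ?_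
  have hj := Finset.mem_Icc.mp hj
  rw [mul_left_comm, PowerSeries.coeff_X_pow_mul', if_pos (by omega), PowerSeries.coeff_mul_C]
  simp only [bernoulliPowerSeries, PowerSeries.coeff_mk]
  rw [Nat.cast_choose ℂ (show j ≤ k + 1 by omega)]
  have h1 := Nat.cast_ne_zero (R := ℂ) |>.mpr (Nat.factorial_ne_zero j)
  have h2 := Nat.cast_ne_zero (R := ℂ) |>.mpr (Nat.factorial_ne_zero (k + 1))
  have h3 := Nat.cast_ne_zero (R := ℂ) |>.mpr (Nat.factorial_ne_zero (k + 1 - j))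
  simp
  field_simp

lemma tendsto_u (q : ℕ → ℂ) (hq : ∀ n, 0 < n → IsPrimitiveRoot (q n) n) (r d : ℕ) :
    Filter.Tendsto (fun n : ℕ => (PowerSeries.coeff d (eser n r (q n))) * (1 / n : ℂ) ^ (r + d))
      Filter.atTop (nhds (PowerSeries.coeff d (Lser r))) := by
  induction d using Nat.strong_induction_on with
  | _ d ih =>
  have hL : PowerSeries.coeff d (Lser r) = 1 / ((r + 1 + d).factorial : ℂ) -
      ∑ p ∈ (Finset.HasAntidiagonal.antidiagonal d).erase (0, d),
        1 / ((p.1 + 1).factorial : ℂ) * PowerSeries.coeff p.2 (Lser r) := by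
    have := congrArg (PowerSeries.coeff d) (Lser_conv r)
    rw [PowerSeries.coeff_mul, ← Finset.add_sum_erase _ _ (show (0, d) ∈ _ by simp)] at this
    simp only [Tser, PowerSeries.coeff_mk] at this
    rw [← this]
    simp [add_comm 1]
  rw [hL]
  have hlim : Filter.Tendsto (fun n : ℕ => n.choose (r + 1 + d) * (1 / n : ℂ) ^ (r + 1 + d) -
      ∑ p ∈ (Finset.HasAntidiagonal.antidiagonal d).erase (0, d), ((n.choose (p.1 + 1) : ℂ) * (1 / n : ℂ) ^ (p.1 + 1)) *
        ((PowerSeries.coeff p.2 (eser n r (q n))) * (1 / n : ℂ) ^ (r + p.2))) Filter.atTop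
      (nhds (1 / ((r + 1 + d).factorial : ℂ) -
      ∑ p ∈ (Finset.HasAntidiagonal.antidiagonal d).erase (0, d),
        1 / ((p.1 + 1).factorial : ℂ) * PowerSeries.coeff p.2 (Lser r))) := by
    refine (tendsto_choose_c _).sub (tendsto_finsetSum _ fun p hp => ?_)
    refine (tendsto_choose_c _).mul (ih _ ?_)
    obtain ⟨h1, h2⟩ := Finset.mem_erase.mp hp
    rw [Finset.HasAntidiagonal.mem_antidiagonal] at h2
    by_contra h3
    exact h1 (Prod.ext (by simp; omega) (by simp; omega))
  refine hlim.congr' ?_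
  filter_upwards [Filter.eventually_gt_atTop 0] with n hn
  rw [← conv' n hn (q n) (hq n hn) r d, ← Finset.add_sum_erase _ _ (show (0, d) ∈ _ by simp)]
  have : (n : ℂ) ≠ 0 := Nat.cast_ne_zero.mpr hn.ne'
  simp [this]

lemma tendsto_n_q :
    Filter.Tendsto (fun n : ℕ => (1 - Complex.exp (2 * (Real.pi : ℂ) * Complex.I / (n : ℂ))) * n)
      Filter.atTop (nhds (-(2 * (Real.pi : ℂ) * Complex.I))) := by
  set c := 2 * (Real.pi : ℂ) * Complex.I with hcdef
  have hd : HasDerivAt (fun t : ℂ => Complex.exp (c * t)) c 0 := by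
    have := (((hasDerivAt_id (0 : ℂ)).const_mul c).cexp)
    simpa using this
  have hs := hd.tendsto_slope_zero
  have ht : Filter.Tendsto (fun n : ℕ => (1 / n : ℂ)) Filter.atTop (nhdsWithin 0 {0}ᶜ) := by
    refine tendsto_nhdsWithin_iff.mpr ⟨?_, ?_⟩
    · exact tendsto_one_div_atTop_nhds_zero_nat
    · filter_upwards [Filter.eventually_gt_atTop 0] with n hn
      simp [hn.ne']
  have := (hs.comp ht).neg
  refine this.congr fun n => ?_
  simp [div_eq_mul_inv]
  ring

/-- the sum formula for `ξ`:
`Σ_{k ∈ I(k,r)} ξ(k) = -((-2πi)^k/(k+1)!)·Σ_{j=1}^r C(k+1,j) B_{k+1-j}`,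
where `B_m` are the Bernoulli numbers with `B_1 = -1/2` (Mathlib's `bernoulli`). -/
theorem xi_sum_formula (k r : ℕ) (hr : 1 ≤ r) (hkr : r ≤ k) :
    Filter.Tendsto
      (fun n : ℕ => ∑ a ∈ indexSet2 k r,
        z n a (Complex.exp (2 * (Real.pi : ℂ) * Complex.I / (n : ℂ))))
      Filter.atTop
      (nhds (-((-(2 * (Real.pi : ℂ) * Complex.I)) ^ k /
            (Nat.factorial (k + 1) : ℂ)) *
        ∑ j ∈ Finset.Icc 1 r,
          ((k + 1).choose j : ℂ) * ((bernoulli (k + 1 - j) : ℚ) : ℂ))) := by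
  have h := (tendsto_n_q.pow k).mul
    (tendsto_u (fun n : ℕ => Complex.exp (2 * (Real.pi : ℂ) * Complex.I / (n : ℂ)))
      (fun n hn => Complex.isPrimitiveRoot_exp n hn.ne') r (k - r))
  rw [Lser_coeff r k hr hkr] at h
  have e : -((-(2 * (Real.pi : ℂ) * Complex.I)) ^ k / (Nat.factorial (k + 1) : ℂ)) *
        ∑ j ∈ Finset.Icc 1 r,
          ((k + 1).choose j : ℂ) * ((bernoulli (k + 1 - j) : ℚ) : ℂ)
      = (-(2 * (Real.pi : ℂ) * Complex.I)) ^ k * (-(1 / ((k + 1).factorial : ℂ)) *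
        ∑ j ∈ Finset.Icc 1 r,
          ((k + 1).choose j : ℂ) * ((bernoulli (k + 1 - j) : ℚ) : ℂ)) := by
    ring
  rw [e]
  refine h.congr' ?_
  filter_upwards [Filter.eventually_gt_atTop 0] with n hn
  rw [sum_z k r n hkr, Nat.add_sub_cancel' hkr, mul_pow]
  have : (n : ℂ) ≠ 0 := Nat.cast_ne_zero.mpr hn.ne'
  have h2 : (n : ℂ) ^ k * (1 / n : ℂ) ^ k = 1 := by
    rw [← mul_pow, mul_one_div_cancel this, one_pow]
  linear_combination (1 - Complex.exp (2 * (Real.pi : ℂ) * Complex.I / (n : ℂ))) ^ k *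
    PowerSeries.coeff (k - r) (eser n r (Complex.exp (2 * (Real.pi : ℂ) * Complex.I / (n : ℂ)))) * h2
end

section
/- Let k, r, s be integers with r ≥ 1, r ≥ s ≥ 0 and k ≥ r+s. Then there exists a rational number c such that the sequence n ↦ Σ_{k ∈ I(k,r,s)} z_n(k; e^{2πi/n}), summed over all indices of weight k, depth r, and height s, converges as n → ∞ to c · (-2πi)^k. -/
open Finset

open Filter Topology

namespace XiSum

/-- The constant `-2πi`. -/
noncomputable def T : ℂ := -(2 * (Real.pi : ℂ) * Complex.I)

/-- The root of unity. -/
noncomputable def ζ (n : ℕ) : ℂ := Complex.exp (2 * (Real.pi : ℂ) * Complex.I / (n : ℂ))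

def Good (k : ℕ) (f : ℕ → ℂ) : Prop :=
  ∃ c : ℚ, Tendsto f atTop (𝓝 ((c : ℂ) * T ^ k))

lemma Good.add {k : ℕ} {f g : ℕ → ℂ} (hf : Good k f) (hg : Good k g) :
    Good k (fun n => f n + g n) := by
  obtain ⟨c, hc⟩ := hf
  obtain ⟨d, hd⟩ := hg
  refine ⟨c + d, ?_⟩
  convert hc.add hd using 2
  push_cast; ring

lemma Good.zero (k : ℕ) : Good k (fun _ => 0) := ⟨0, by simp⟩

lemma Good.mul {k l : ℕ} {f g : ℕ → ℂ} (hf : Good k f) (hg : Good l g) :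
    Good (k + l) (fun n => f n * g n) := by
  obtain ⟨c, hc⟩ := hf
  obtain ⟨d, hd⟩ := hg
  refine ⟨c * d, ?_⟩
  convert hc.mul hd using 2
  push_cast; ring

lemma Good.rat_mul {k : ℕ} (q : ℚ) {f : ℕ → ℂ} (hf : Good k f) :
    Good k (fun n => (q : ℂ) * f n) := by
  obtain ⟨c, hc⟩ := hf
  refine ⟨q * c, ?_⟩
  convert hc.const_mul (q : ℂ) using 2
  push_cast; ring

lemma Good.congr {k : ℕ} {f g : ℕ → ℂ} (hf : Good k f) (h : ∀ᶠ n in atTop, f n = g n) :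
    Good k g := by
  obtain ⟨c, hc⟩ := hf
  exact ⟨c, hc.congr' h⟩

lemma Good.sum {ι : Type*} {k : ℕ} (s : Finset ι) {f : ι → ℕ → ℂ}
    (hf : ∀ i ∈ s, Good k (f i)) : Good k (fun n => ∑ i ∈ s, f i n) := by
  classical
  induction s using Finset.induction_on with
  | empty => simpa using Good.zero k
  | insert a s ha ih =>
    simp only [Finset.sum_insert ha]
    exact (hf a (by simp)).add (ih fun i hi => hf i (by simp [hi]))

/-- elementary symmetric function of a family -/
def E {R : Type*} [CommRing R] {n : ℕ} (f : Fin n → R) (k : ℕ) : R :=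
  ∑ t ∈ powersetCard k (univ : Finset (Fin n)), ∏ i ∈ t, f i

lemma aeval_esymm {R : Type*} [CommRing R] {n : ℕ} (f : Fin n → R) (k : ℕ) :
    MvPolynomial.aeval f (MvPolynomial.esymm (Fin n) ℤ k) = E f k := by
  simp [MvPolynomial.esymm, E]

lemma aeval_psum {R : Type*} [CommRing R] {n : ℕ} (f : Fin n → R) (k : ℕ) :
    MvPolynomial.aeval f (MvPolynomial.psum (Fin n) ℤ k) = ∑ i, f i ^ k := by
  simp [MvPolynomial.psum]

lemma newton_E {R : Type*} [CommRing R] {n : ℕ} (f : Fin n → R) (k : ℕ) :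
    (k : R) * E f k = (-1) ^ (k + 1) *
      ∑ a ∈ antidiagonal k with a.1 < k, (-1) ^ a.1 * E f a.1 * ∑ i, f i ^ a.2 := by
  have h := congrArg (MvPolynomial.aeval f) (MvPolynomial.mul_esymm_eq_sum (Fin n) ℤ k)
  simpa [map_sum, map_mul, aeval_esymm, aeval_psum] using h

lemma newton_P {R : Type*} [CommRing R] {n : ℕ} (f : Fin n → R) (k : ℕ) (hk : 0 < k) :
    ∑ i, f i ^ k = (-1) ^ (k + 1) * k * E f k -
    ∑ a ∈ antidiagonal k with a.1 ∈ Set.Ioo 0 k, (-1) ^ a.1 * E f a.1 * ∑ i, f i ^ a.2 := by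
  have h := congrArg (MvPolynomial.aeval f) (MvPolynomial.psum_eq_mul_esymm_sub_sum (Fin n) ℤ k hk)
  rw [map_sub, map_sum] at h
  simpa [map_mul, aeval_esymm, aeval_psum] using h

lemma E_smul {n : ℕ} (c : ℂ) (f : Fin n → ℂ) (k : ℕ) :
    E (fun i => c * f i) k = c ^ k * E f k := by
  unfold E
  rw [Finset.mul_sum]
  refine Finset.sum_congr rfl fun t ht => ?_
  rw [Finset.prod_mul_distrib, Finset.prod_const, (mem_powersetCard.1 ht).2]

open Polynomial in
lemma coeff_prod_E {n : ℕ} (f : Fin n → ℂ) (k : ℕ) :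
    (∏ i, (1 + C (f i) * X) : ℂ[X]).coeff k = E f k := by
  rw [Finset.prod_one_add, Polynomial.finsetSum_coeff, E]
  have : ∀ t : Finset (Fin n), (∏ i ∈ t, (C (f i) * X) : ℂ[X]).coeff k
      = if t.card = k then ∏ i ∈ t, f i else 0 := by
    intro t
    rw [Finset.prod_mul_distrib, Finset.prod_const, ← map_prod, coeff_C_mul, coeff_X_pow]
    simp [eq_comm]
  simp only [this]
  rw [← Finset.sum_filter]
  congr 1
  ext t; simp [mem_powersetCard]

open Polynomial in
lemma prod_X_sub {n : ℕ} (hn : 0 < n) {q : ℂ} (hq : IsPrimitiveRoot q n) :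
    (∏ m : Fin n, (X - C (q ^ (m : ℕ))) : ℂ[X]) = X ^ n - 1 := by
  rw [X_pow_sub_one_eq_prod hn hq]
  have hinj : Function.Injective (fun m : Fin n => q ^ (m : ℕ)) := fun a b h =>
    Fin.ext (hq.pow_inj a.2 b.2 h)
  have himg : Polynomial.nthRootsFinset n (1 : ℂ) = univ.image (fun m : Fin n => q ^ (m : ℕ)) := by
    symm
    apply Finset.eq_of_subset_of_card_le
    · intro x hx
      obtain ⟨m, -, rfl⟩ := Finset.mem_image.1 hx
      rw [Polynomial.mem_nthRootsFinset hn, ← pow_mul, mul_comm, pow_mul, hq.pow_eq_one, one_pow]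
    · rw [hq.card_nthRootsFinset, Finset.card_image_of_injective _ hinj]; simp
  rw [himg, Finset.prod_image (fun a _ b _ h => hinj h)]

open Polynomial in
lemma E_root {n : ℕ} (hn : 0 < n) {q : ℂ} (hq : IsPrimitiveRoot q n) (k : ℕ) :
    E (fun m : Fin n => (1 - q ^ (m : ℕ))⁻¹) k = (n.choose (k + 1) : ℂ) / n := by
  obtain ⟨N, rfl⟩ : ∃ N, n = N + 1 := ⟨n - 1, by omega⟩
  set f : Fin (N + 1) → ℂ := fun m => (1 - q ^ (m : ℕ))⁻¹ with hf
  have h1 := congrArg (fun p : ℂ[X] => p.comp (1 + X)) (prod_X_sub hn hq)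
  simp only [Polynomial.prod_comp] at h1
  have hne : ∀ i : Fin N, (1 : ℂ) - q ^ ((i : ℕ) + 1) ≠ 0 := by
    intro i h
    exact hq.pow_ne_one_of_pos_of_lt (Nat.succ_ne_zero _) (by omega) (sub_eq_zero.1 h).symm
  set D : ℂ := ∏ i : Fin N, (1 - q ^ ((i : ℕ) + 1)) with hD
  have h2 : (X : ℂ[X]) * (C D * ∏ i, (1 + C (f i) * X)) = (1 + X) ^ (N + 1) - 1 := by
    rw [show ((1 + X) ^ (N + 1) - 1 : ℂ[X]) = (X ^ (N + 1) - 1 : ℂ[X]).comp (1 + X) by simp, ← h1]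
    rw [Fin.prod_univ_succ, Fin.prod_univ_succ, hD, map_prod]
    have : f 0 = 0 := by simp [hf]
    rw [this]
    simp only [Fin.val_zero, pow_zero, map_zero, zero_mul, add_zero, one_mul, map_one,
      Polynomial.sub_comp, Polynomial.X_comp, Polynomial.one_comp, add_sub_cancel_left,
      Polynomial.C_comp, Fin.val_succ]
    rw [← Finset.prod_mul_distrib]
    congr 1
    refine Finset.prod_congr rfl fun i _ => ?_
    have : (C (1 - q ^ ((i : ℕ) + 1)) * C (f i.succ) : ℂ[X]) = 1 := by
      rw [← C_mul, hf]; simp only [Fin.val_succ]; rw [mul_inv_cancel₀ (hne i), C_1]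
    rw [mul_add, ← mul_assoc, this, C_sub, C_1]; ring
  have h3 : ∀ j, D * E f j = ((N + 1).choose (j + 1) : ℂ) := by
    intro j
    have := congrArg (fun p : ℂ[X] => p.coeff (j + 1)) h2
    simp only [Polynomial.coeff_X_mul, coeff_C_mul, coeff_prod_E, coeff_sub,
      Polynomial.coeff_one_add_X_pow] at this
    rw [this, Polynomial.coeff_one]; simp
  have h0 := h3 0
  have hE0 : E f 0 = 1 := by simp [E]
  rw [hE0] at h0
  have hDn : D = ((N + 1 : ℕ) : ℂ) := by simpa using h0
  have := h3 k
  rw [hDn] at this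
  rw [eq_div_iff (Nat.cast_ne_zero.2 hn.ne'), mul_comm, this]

lemma tendsto_choose (k : ℕ) :
    Tendsto (fun n : ℕ => (n.choose k : ℂ) / (n : ℂ) ^ k) atTop (𝓝 (1 / (k.factorial : ℂ))) := by
  have h := ProbabilityTheory.tendsto_choose_mul_pow_atTop (p := fun n : ℕ => (n : ℝ)⁻¹) (r := 1) k
    (by
      refine tendsto_const_nhds.congr' ?_
      filter_upwards [eventually_gt_atTop 0] with n hn
      have : (n : ℝ) ≠ 0 := by positivity
      field_simp)
  have h2 := (Complex.continuous_ofReal.tendsto _).comp h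
  convert h2 using 2
  · simp [div_eq_mul_inv]
  · simp

lemma tendsto_q : Tendsto (fun n : ℕ => (n : ℂ) * (1 - ζ n)) atTop (𝓝 T) := by
  have hd : HasDerivAt (fun z : ℂ => Complex.exp (-T * z)) (-T) 0 := by
    have := ((hasDerivAt_id (0 : ℂ)).const_mul (-T)).cexp
    simpa using this
  have h := hd.tendsto_slope_zero
  have h1 : Tendsto (fun n : ℕ => ((n : ℂ))⁻¹) atTop (𝓝[≠] 0) := by
    rw [tendsto_nhdsWithin_iff]
    refine ⟨tendsto_inv_atTop_nhds_zero_nat, ?_⟩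
    filter_upwards [eventually_gt_atTop 0] with n hn
    have : (n : ℂ) ≠ 0 := by exact_mod_cast hn.ne'
    simpa using this
  have h2 := (h.comp h1).neg
  rw [neg_neg] at h2
  refine h2.congr fun n => ?_
  simp [ζ, T, div_eq_mul_inv]
  ring

lemma tendsto_one_sub : Tendsto (fun n : ℕ => 1 - ζ n) atTop (𝓝 0) := by
  have h := tendsto_q.mul (tendsto_inv_atTop_nhds_zero_nat (𝕜 := ℂ))
  rw [mul_zero] at h
  refine h.congr' ?_
  filter_upwards [eventually_gt_atTop 0] with n hn
  have : (n : ℂ) ≠ 0 := by exact_mod_cast hn.ne'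
  field_simp

/-- `1/[m]_q` -/
noncomputable def V (n : ℕ) (m : Fin n) : ℂ := (1 - ζ n) * (1 - ζ n ^ (m : ℕ))⁻¹

lemma good_E (k : ℕ) : Good k (fun n => E (V n) k) := by
  refine ⟨1 / ((k + 1).factorial : ℚ), ?_⟩
  have h := (tendsto_choose (k + 1)).mul (tendsto_q.pow k)
  push_cast
  refine h.congr' ?_
  filter_upwards [eventually_gt_atTop 0] with n hn
  have hn' : (n : ℂ) ≠ 0 := by exact_mod_cast hn.ne'
  have : E (V n) k = (1 - ζ n) ^ k * ((n.choose (k + 1) : ℂ) / n) := by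
    rw [← E_root hn (Complex.isPrimitiveRoot_exp n hn.ne') k, ← E_smul]; rfl
  rw [this, mul_pow, pow_succ]
  field_simp

lemma good_P (k : ℕ) (hk : 0 < k) : Good k (fun n => ∑ m, V n m ^ k) := by
  induction k using Nat.strong_induction_on with
  | _ k ih =>
    have h1 : Good k (fun n => (((-1) ^ (k + 1) * k : ℚ) : ℂ) * E (V n) k) :=
      (good_E k).rat_mul _
    have h2 : Good k (fun n => ((-1 : ℚ) : ℂ) * ∑ a ∈ antidiagonal k with a.1 ∈ Set.Ioo 0 k,
        (((-1) ^ a.1 : ℚ) : ℂ) * (E (V n) a.1 * ∑ i, V n i ^ a.2)) := by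
      refine (Good.sum _ fun a ha => ?_).rat_mul _
      rw [mem_filter, HasAntidiagonal.mem_antidiagonal, Set.mem_Ioo] at ha
      have := ((good_E a.1).mul (ih a.2 (by omega) (by omega))).rat_mul ((-1) ^ a.1)
      rwa [ha.1] at this
    refine (h1.add h2).congr (Eventually.of_forall fun n => ?_)
    rw [newton_P (V n) k hk]
    push_cast
    rw [neg_one_mul, ← sub_eq_add_neg]
    simp only [mul_assoc]

/-- mixed power sums -/
lemma good_S (d k : ℕ) (h : d < k) :
    Good k (fun n => ∑ m : Fin n, (ζ n ^ (m : ℕ)) ^ d * V n m ^ k) := by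
  induction d generalizing k with
  | zero => simpa using good_P k h
  | succ d ih =>
    obtain ⟨j, rfl⟩ : ∃ j, k = j + 2 := ⟨k - 2, by omega⟩
    have h1 := ih (j + 2) (by omega)
    have h2 := ih (j + 1) (by omega)
    have h3 : Good 1 (fun n => -(1 - ζ n)) := ⟨0, by simpa using tendsto_one_sub.neg⟩
    have h4 := h2.mul h3
    refine (h1.add h4).congr (Eventually.of_forall fun n => ?_)
    rw [Finset.sum_mul, ← Finset.sum_add_distrib]
    refine Finset.sum_congr rfl fun m _ => ?_
    have key : ζ n ^ (m : ℕ) * V n m ^ 2 = V n m ^ 2 - (1 - ζ n) * V n m := by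
      unfold V
      by_cases hu : (1 : ℂ) - ζ n ^ (m : ℕ) = 0
      · simp [hu]
      · field_simp
        ring
    have : (ζ n ^ (m : ℕ)) ^ (d + 1) * V n m ^ (j + 2)
      = (ζ n ^ (m : ℕ)) ^ d * V n m ^ j * (ζ n ^ (m : ℕ) * V n m ^ 2) := by ring
    rw [this, key]; ring

/-- the summand -/
noncomputable def F (n : ℕ) (a : ℕ) (m : Fin n) : ℂ :=
  (ζ n ^ (m : ℕ)) ^ (a - 1) * V n m ^ a

open Polynomial

noncomputable def ht (a : ℕ) : ℕ := if 2 ≤ a then 1 else 0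

noncomputable def G (K n : ℕ) (m : Fin n) : ℂ[X][X] :=
  ∑ a ∈ Icc 1 K, monomial a (monomial (ht a) (F n a m))

lemma prod_monomial {ι R : Type*} [CommRing R] (s : Finset ι) (a : ι → ℕ) (c : ι → R) :
    ∏ i ∈ s, monomial (a i) (c i) = monomial (∑ i ∈ s, a i) (∏ i ∈ s, c i) := by
  classical
  induction s using Finset.induction_on with
  | empty => simp
  | insert x s hx ih =>
    rw [Finset.prod_insert hx, ih, monomial_mul_monomial, Finset.sum_insert hx,
      Finset.prod_insert hx]

lemma coeff_prod_G (K n r k s : ℕ) (m : Fin r → Fin n) :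
    ((∏ i, G K n (m i)).coeff k).coeff s =
      ∑ a ∈ (Fintype.piFinset fun _ : Fin r => Icc 1 K) with
        (∑ i, a i = k ∧ ∑ i, ht (a i) = s), ∏ i, F n (a i) (m i) := by
  unfold G
  rw [Finset.prod_univ_sum, finsetSum_coeff, finsetSum_coeff, Finset.sum_filter]
  refine Finset.sum_congr rfl fun a _ => ?_
  rw [prod_monomial, prod_monomial, coeff_monomial]
  by_cases h1 : ∑ i, a i = k
  · simp [h1, coeff_monomial]
  · simp [h1]

def GoodP (P : ℕ → ℂ[X][X]) : Prop := ∀ k s, Good k (fun n => ((P n).coeff k).coeff s)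

lemma GoodP.sum {ι : Type*} (t : Finset ι) {P : ι → ℕ → ℂ[X][X]}
    (h : ∀ i ∈ t, GoodP (P i)) : GoodP (fun n => ∑ i ∈ t, P i n) := by
  intro k s
  simp only [finsetSum_coeff]
  exact Good.sum _ fun i hi => h i hi k s

lemma GoodP.mul {P Q : ℕ → ℂ[X][X]} (hP : GoodP P) (hQ : GoodP Q) :
    GoodP (fun n => P n * Q n) := by
  intro k s
  simp only [coeff_mul, finsetSum_coeff]
  refine Good.sum _ fun a ha => Good.sum _ fun b _ => ?_
  rw [HasAntidiagonal.mem_antidiagonal] at ha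
  have := (hP a.1 b.1).mul (hQ a.2 b.2)
  rwa [ha] at this

lemma GoodP.neg_pow_mul {P : ℕ → ℂ[X][X]} (hP : GoodP P) (j : ℕ) :
    GoodP (fun n => (-1) ^ j * P n) := by
  intro k s
  rcases neg_one_pow_eq_or ℂ[X][X] j with h | h
  · simpa [h] using hP k s
  · have := (hP k s).rat_mul (-1)
    simpa [h] using this

lemma goodP_psum (K j : ℕ) (hj : 0 < j) : GoodP (fun n => ∑ m, G K n m ^ j) := by
  intro k s
  have hrw : ∀ n, ((∑ m, G K n m ^ j).coeff k).coeff s =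
      ∑ a ∈ (Fintype.piFinset fun _ : Fin j => Icc 1 K) with
        (∑ i, a i = k ∧ ∑ i, ht (a i) = s),
        ∑ m : Fin n, (ζ n ^ (m : ℕ)) ^ (k - j) * V n m ^ k := by
    intro n
    rw [finsetSum_coeff, finsetSum_coeff, Finset.sum_comm]
    refine Finset.sum_congr rfl fun m _ => ?_
    have := coeff_prod_G K n j k s (fun _ => m)
    simp only [Finset.prod_const, Finset.card_univ, Fintype.card_fin] at this
    rw [this]
    refine Finset.sum_congr rfl fun a ha => ?_
    rw [mem_filter, Fintype.mem_piFinset] at ha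
    obtain ⟨h1, h2, -⟩ := ha
    unfold F
    rw [Finset.prod_mul_distrib, Finset.prod_pow_eq_pow_sum, Finset.prod_pow_eq_pow_sum, h2]
    congr 2
    have : ∑ i, (a i - 1) + j = k := by
      rw [← h2]
      have : ∑ i, a i = ∑ i : Fin j, ((a i - 1) + 1) :=
        Finset.sum_congr rfl fun i _ => by have := (mem_Icc.1 (h1 i)).1; omega
      rw [this, Finset.sum_add_distrib]; simp
    omega
  simp only [hrw]
  refine Good.sum _ fun a ha => ?_
  rw [mem_filter, Fintype.mem_piFinset] at ha
  obtain ⟨h1, h2, -⟩ := ha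
  have : 0 < k := by
    rw [← h2]
    exact Finset.sum_pos (fun i _ => (mem_Icc.1 (h1 i)).1) ⟨⟨0, hj⟩, mem_univ _⟩
  exact good_S _ _ (by omega)

lemma goodP_E (K r : ℕ) : GoodP (fun n => E (G K n) r) := by
  induction r using Nat.strong_induction_on with
  | _ r ih =>
    rcases Nat.eq_zero_or_pos r with rfl | hr
    · intro k s
      have : ∀ n, E (G K n) 0 = 1 := by intro n; simp [E]
      simp only [this]
      by_cases hk : k = 0
      · subst hk
        by_cases hs : s = 0
        · exact ⟨1, by simp [hs]⟩
        · exact ⟨0, by simp [coeff_one, hs]⟩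
      · exact ⟨0, by simp [coeff_one, hk]⟩
    · have h : GoodP (fun n => (-1) ^ (r + 1) * ∑ a ∈ antidiagonal r with a.1 < r,
          (-1) ^ a.1 * E (G K n) a.1 * ∑ i, G K n i ^ a.2) := by
        refine GoodP.neg_pow_mul (GoodP.sum _ fun a ha => ?_) _
        rw [mem_filter, HasAntidiagonal.mem_antidiagonal] at ha
        exact ((ih a.1 ha.2).neg_pow_mul _).mul (goodP_psum K a.2 (by omega))
      intro k s
      refine ((h k s).rat_mul ((r : ℚ)⁻¹)).congr (Eventually.of_forall fun n => ?_)
      simp only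
      rw [← newton_E]
      have hr' : (r : ℂ) ≠ 0 := by exact_mod_cast hr.ne'
      have : ((r : ℂ[X][X])) = C (C (r : ℂ)) := by simp
      rw [this, coeff_C_mul, coeff_C_mul]
      push_cast
      field_simp

/-- strictly decreasing tuples correspond to subsets -/
lemma sum_msets {R : Type*} [CommRing R] (n r : ℕ) (f : Fin n → R)
    (h0 : ∀ m : Fin n, (m : ℕ) = 0 → f m = 0) :
    ∑ m ∈ msets n r, ∏ i, f (m i) = E f r := by
  have hanti : ∀ m ∈ msets n r, StrictAnti m := by
    intro m hm i j hij
    exact (mem_filter.1 hm).2.1 i j hij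
  unfold E
  refine Finset.sum_of_injOn (fun m => univ.image m) ?_ ?_ ?_ ?_
  · intro m hm m' hm' h
    have a1 := hanti m hm
    have a2 := hanti m' hm'
    have hr : Set.range m = Set.range m' := by
      have := congrArg (fun s : Finset (Fin n) => (s : Set (Fin n))) h
      simpa using this
    have b1 : StrictMono (m ∘ Fin.rev) := a1.comp Fin.rev_strictAnti
    have b2 : StrictMono (m' ∘ Fin.rev) := a2.comp Fin.rev_strictAnti
    have : m ∘ Fin.rev = m' ∘ Fin.rev := by
      rw [← b1.range_inj b2, Fin.rev_surjective.range_comp, Fin.rev_surjective.range_comp, hr]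
    exact Fin.rev_surjective.injective_comp_right this
  · intro m hm
    simp only [mem_coe, mem_powersetCard]
    refine ⟨subset_univ _, ?_⟩
    rw [Finset.card_image_of_injective _ (hanti m hm).injective]; simp
  · intro t ht hnot
    by_contra hne
    apply hnot
    have hc := (mem_powersetCard.1 ht).2
    have hmem : ∀ i, t.orderEmbOfFin hc i ∈ t := fun i => Finset.orderEmbOfFin_mem _ _ _
    refine ⟨t.orderEmbOfFin hc ∘ Fin.rev, ?_, ?_⟩
    · simp only [msets, coe_filter, mem_univ, true_and, Set.mem_setOf_eq, Function.comp]
      refine ⟨fun i j hij => (t.orderEmbOfFin hc).strictMono (Fin.rev_lt_rev.2 hij), fun i => ?_⟩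
      by_contra hz
      exact hne (Finset.prod_eq_zero (hmem (Fin.rev i)) (h0 _ (by omega)))
    · apply Finset.coe_injective
      simp only [coe_image, coe_univ, Set.image_univ]
      rw [Fin.rev_surjective.range_comp, Finset.range_orderEmbOfFin]
  · intro m hm
    rw [Finset.prod_image (fun a _ b _ h => (hanti m hm).injective h)]

lemma F_eq (n a : ℕ) (m : Fin n) :
    ζ n ^ ((a - 1) * (m : ℕ)) / ((1 - ζ n ^ (m : ℕ)) / (1 - ζ n)) ^ a = F n a m := by
  unfold F V
  rw [div_eq_mul_inv, ← inv_pow, inv_div, mul_comm (a - 1), pow_mul, div_eq_mul_inv]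

lemma G_zero (K n : ℕ) (m : Fin n) (hm : (m : ℕ) = 0) : G K n m = 0 := by
  unfold G
  refine Finset.sum_eq_zero fun a ha => ?_
  have : a ≠ 0 := by have := (mem_Icc.1 ha).1; omega
  simp [F, V, hm, this]

lemma indexSet_eq (k r s : ℕ) : indexSet3 k r s =
    {a ∈ (Fintype.piFinset fun _ : Fin r => Icc 1 k) | ∑ i, a i = k ∧ ∑ i, ht (a i) = s} := by
  ext a
  have hh : (univ.filter fun i => 2 ≤ a i).card = ∑ i, ht (a i) := by
    rw [Finset.card_filter]; rfl
  simp only [indexSet3, mem_filter, Finset.Nat.mem_antidiagonalTuple, Fintype.mem_piFinset,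
    mem_Icc, hh]
  constructor
  · rintro ⟨h1, h2, h3⟩
    refine ⟨fun i => ⟨h2 i, ?_⟩, h1, h3⟩
    rw [← h1]
    exact Finset.single_le_sum (fun _ _ => Nat.zero_le _) (mem_univ i)
  · rintro ⟨h1, h2, h3⟩
    exact ⟨h2, fun i => (h1 i).1, h3⟩

lemma main_eq (k r s n : ℕ) :
    ∑ a ∈ indexSet3 k r s, z n a (ζ n) = ((E (G k n) r).coeff k).coeff s := by
  rw [← sum_msets n r _ (G_zero k n), finsetSum_coeff, finsetSum_coeff]
  simp only [coeff_prod_G, ← indexSet_eq]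
  rw [Finset.sum_comm]
  simp only [z, F_eq]

end XiSum

/-- the sum of `ξ(k)` over indices of fixed weight `k`, depth `r`
and height `s` exists and lies in `(-2πi)^k·ℚ`. -/
theorem xi_sum_weight_depth_height_rational (k r s : ℕ) (hr : 1 ≤ r)
    (hsr : s ≤ r) (hkrs : r + s ≤ k) :
    ∃ c : ℚ, Filter.Tendsto
      (fun n : ℕ => ∑ a ∈ indexSet3 k r s,
        z n a (Complex.exp (2 * (Real.pi : ℂ) * Complex.I / (n : ℂ))))
      Filter.atTop
      (nhds ((c : ℂ) * (-(2 * (Real.pi : ℂ) * Complex.I)) ^ k)) := by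
  obtain ⟨c, hc⟩ := XiSum.goodP_E k r k s
  refine ⟨c, hc.congr fun n => ?_⟩
  exact (XiSum.main_eq k r s n).symm
end
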